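/- There is no ternary map f : {0,1,3}³ → {0,1,3} that preserves each of S1, S2, S3, S4 and satisfies f(h,h,i)=f(h,i,h)=f(i,h,h)=h for all h,i∈{1,3}. In particular, no ternary polymorphism of the structure D restricts to a majority operation on {1,3}. -/

import Mathlib

namespace Paper

/-- The relation `S1 = {(0,3),(1,1),(3,1),(3,3)}`. -/
def S1 : Set (ℕ × ℕ) := {(0, 3), (1, 1), (3, 1), (3, 3)}

/-- The relation `S2 = {(1,0),(1,1),(3,1),(3,3)}`. -/
def S2 : Set (ℕ × ℕ) := {(1, 0), (1, 1), (3, 1), (3, 3)}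

/-- The relation `S3 = {(1,3),(3,1),(3,3)}`. -/
def S3 : Set (ℕ × ℕ) := {(1, 3), (3, 1), (3, 3)}

/-- The relation `S4 = {(1,1),(1,3),(3,1)}`. -/
def S4 : Set (ℕ × ℕ) := {(1, 1), (1, 3), (3, 1)}

/-- The domain `{0,1,3}` of the structure `D`. -/
def Dom : Set ℕ := {0, 1, 3}

/-- No ternary map on `{0,1,3}` preserving `S1, S2, S3, S4` satisfies the
majority identities `f(h,h,i)=f(h,i,h)=f(i,h,h)=h` for all `h,i ∈ {1,3}`; in
particular no ternary polymorphism of `D` restricts to a majority operation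
on `{1,3}`. -/
theorem stmt3 :
    ¬ ∃ f : ℕ → ℕ → ℕ → ℕ,
      (∀ a ∈ Dom, ∀ b ∈ Dom, ∀ c ∈ Dom, f a b c ∈ Dom) ∧
      (∀ a b a' b' a'' b'' : ℕ, (a, b) ∈ S1 → (a', b') ∈ S1 → (a'', b'') ∈ S1 →
        (f a a' a'', f b b' b'') ∈ S1) ∧
      (∀ a b a' b' a'' b'' : ℕ, (a, b) ∈ S2 → (a', b') ∈ S2 → (a'', b'') ∈ S2 →
        (f a a' a'', f b b' b'') ∈ S2) ∧
      (∀ a b a' b' a'' b'' : ℕ, (a, b) ∈ S3 → (a', b') ∈ S3 → (a'', b'') ∈ S3 →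
        (f a a' a'', f b b' b'') ∈ S3) ∧
      (∀ a b a' b' a'' b'' : ℕ, (a, b) ∈ S4 → (a', b') ∈ S4 → (a'', b'') ∈ S4 →
        (f a a' a'', f b b' b'') ∈ S4) ∧
      (∀ h ∈ ({1, 3} : Set ℕ), ∀ i ∈ ({1, 3} : Set ℕ),
        f h h i = h ∧ f h i h = h ∧ f i h h = h) := by
  rintro ⟨f, -, h1, h2, -, -, hmaj⟩
  have f331 : f 3 3 1 = 3 := (hmaj 3 (by simp) 1 (by simp)).1
  have f311 : f 3 1 1 = 1 := (hmaj 1 (by simp) 3 (by simp)).2.2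
  have f131 : f 1 3 1 = 1 := (hmaj 1 (by simp) 3 (by simp)).2.1
  have hp := h1 0 3 3 3 1 1 (by simp [S1]) (by simp [S1]) (by simp [S1])
  have hq := h1 0 3 3 1 1 1 (by simp [S1]) (by simp [S1]) (by simp [S1])
  have hr := h2 1 0 3 3 1 1 (by simp [S2]) (by simp [S2]) (by simp [S2])
  rw [f331] at hp
  rw [f311] at hq
  rw [f131] at hr
  simp only [S1, S2, Set.mem_insert_iff, Set.mem_singleton_iff, Prod.mk.injEq] at hp hq hr
  omega

end Paper
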